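/- Let σ_x ≥ σ_y > 0 and σ_{k,x} ≥ σ_{k,y} > 0, and θ_k ∈ ℝ. Then for every θ_s ∈ ℝ, tr( (R(θ_s) Λ R(θ_s)ᵀ)⁻¹ · (R(θ_k) Λ_k R(θ_k)ᵀ) ) ≥ (σ_{k,x} σ_y + σ_{k,y} σ_x)/(σ_x σ_y), and equality holds whenever θ_s − θ_k = nπ for some integer n. If moreover σ_x > σ_y and σ_{k,x} > σ_{k,y}, then equality holds only when θ_s − θ_k is an integer multiple of π. -/

import Mathlib

open Real Matrix

/-- The 2×2 rotation matrix. -/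
noncomputable def rot (θ : ℝ) : Matrix (Fin 2) (Fin 2) ℝ :=
  !![Real.cos θ, -Real.sin θ; Real.sin θ, Real.cos θ]

theorem rot_mul_transpose (θ : ℝ) : rot θ * (rot θ)ᵀ = 1 := by
  ext i j
  fin_cases i <;> fin_cases j <;> simp [rot, Matrix.mul_apply, Fin.sum_univ_two] <;>
    linarith [Real.sin_sq_add_cos_sq θ]

theorem transpose_mul_rot (θ : ℝ) : (rot θ)ᵀ * rot θ = 1 :=
  mul_eq_one_comm.mp (rot_mul_transpose θ)

theorem inv_rot_conj_diag {a b : ℝ} (ha : a ≠ 0) (hb : b ≠ 0) (θ : ℝ) :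
    (rot θ * !![a, 0; 0, b] * (rot θ)ᵀ)⁻¹ = rot θ * !![a⁻¹, 0; 0, b⁻¹] * (rot θ)ᵀ := by
  apply Matrix.inv_eq_right_inv
  have hd : !![a, 0; 0, b] * !![a⁻¹, 0; 0, b⁻¹] = (1 : Matrix (Fin 2) (Fin 2) ℝ) := by
    simp [Matrix.one_fin_two, ha, hb]
  calc _ = rot θ * (!![a, 0; 0, b] * ((rot θ)ᵀ * rot θ) * !![a⁻¹, 0; 0, b⁻¹]) * (rot θ)ᵀ := by
        simp only [Matrix.mul_assoc]
    _ = 1 := by rw [transpose_mul_rot, Matrix.mul_one, hd, Matrix.mul_one, rot_mul_transpose]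

theorem trace_inv_rot_conj_mul_rot_conj {a b : ℝ} (ha : a ≠ 0) (hb : b ≠ 0) (c d θ φ : ℝ) :
    ((rot θ * !![a, 0; 0, b] * (rot θ)ᵀ)⁻¹ * (rot φ * !![c, 0; 0, d] * (rot φ)ᵀ)).trace
      = (c * b + d * a) / (a * b) + (a - b) * (c - d) / (a * b) * Real.sin (θ - φ) ^ 2 := by
  have hs : (Real.cos θ * Real.cos φ + Real.sin θ * Real.sin φ) ^ 2
      = 1 - Real.sin (θ - φ) ^ 2 := by
    rw [← Real.cos_sub, Real.cos_sq']
  calc _ = (c / a + d / b) * (Real.cos θ * Real.cos φ + Real.sin θ * Real.sin φ) ^ 2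
        + (d / a + c / b) * Real.sin (θ - φ) ^ 2 := by
        rw [inv_rot_conj_diag ha hb, Real.sin_sub]
        simp only [rot, Matrix.trace_fin_two, Matrix.mul_apply, Fin.sum_univ_two,
          Matrix.transpose_apply]
        simp
        ring
    _ = _ := by
        rw [hs]
        field_simp
        ring

theorem stmt7 (σx σy σkx σky : ℝ) (h1 : σx ≥ σy) (h2 : σy > 0)
    (h3 : σkx ≥ σky) (h4 : σky > 0) (θk : ℝ) :
    (∀ θs : ℝ,
      (σkx * σy + σky * σx) / (σx * σy) ≤
        ((rot θs * !![σx, 0; 0, σy] * (rot θs)ᵀ)⁻¹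
          * (rot θk * !![σkx, 0; 0, σky] * (rot θk)ᵀ)).trace) ∧
    (∀ θs : ℝ, (∃ n : ℤ, θs - θk = n * Real.pi) →
      ((rot θs * !![σx, 0; 0, σy] * (rot θs)ᵀ)⁻¹
          * (rot θk * !![σkx, 0; 0, σky] * (rot θk)ᵀ)).trace
        = (σkx * σy + σky * σx) / (σx * σy)) ∧
    (σy < σx → σky < σkx → ∀ θs : ℝ,
      ((rot θs * !![σx, 0; 0, σy] * (rot θs)ᵀ)⁻¹
          * (rot θk * !![σkx, 0; 0, σky] * (rot θk)ᵀ)).trace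
        = (σkx * σy + σky * σx) / (σx * σy) →
      ∃ n : ℤ, θs - θk = n * Real.pi) := by
  have hx : 0 < σx := h2.trans_le h1
  have hxy : 0 < σx * σy := mul_pos hx h2
  simp only [trace_inv_rot_conj_mul_rot_conj hx.ne' h2.ne']
  refine ⟨fun θs => ?_, ?_, fun hσ hσk θs h => ?_⟩
  · have : 0 ≤ (σx - σy) * (σkx - σky) / (σx * σy) :=
      div_nonneg (mul_nonneg (sub_nonneg.mpr h1) (sub_nonneg.mpr h3)) hxy.le
    exact le_add_of_nonneg_right (mul_nonneg this (sq_nonneg _))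
  · rintro θs ⟨n, hn⟩
    simp [hn, Real.sin_int_mul_pi]
  · have hc : (σx - σy) * (σkx - σky) / (σx * σy) ≠ 0 :=
      (div_pos (mul_pos (sub_pos.mpr hσ) (sub_pos.mpr hσk)) hxy).ne'
    have hsin : Real.sin (θs - θk) = 0 :=
      eq_zero_of_pow_eq_zero ((mul_eq_zero.mp (add_eq_left.mp h)).resolve_left hc)
    obtain ⟨n, hn⟩ := Real.sin_eq_zero_iff.mp hsin
    exact ⟨n, hn.symm⟩
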